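/- The center of B equals the k-linear span of the products j(z) · ζ(w) with z in the center Z(A) of A and w in the center Z(H) of H; that is, Z(B) = Z(A) · ζ(Z(H)) (under the identifications j, ζ). -/

import Mathlib

/-!
Context: `H` is a Hopf algebra over a field `k`, `A` is a right `H`-module algebra,
`B` is a model of the cross product `A ⋊ H`, `f : H → A` is a realization of `H` in `A`,
and `ζ : H → B` is defined by `ζ(g) = Σ ι(g₍₁₎) · j(f(S g₍₂₎))`.
-/

open TensorProduct

/-- A right module-algebra action of a Hopf algebra `H` on a unital associative
`k`-algebra `A`: a `k`-bilinear map `◁ : A × H → A` (curried as `act`) such that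
`a ◁ (g g') = (a ◁ g) ◁ g'`, `a ◁ 1 = a`,
`(a a') ◁ g = Σ (a ◁ g₍₁₎)(a' ◁ g₍₂₎)` and `1 ◁ g = ε(g) 1`. -/
structure RightModuleAlgebra (k H A : Type*) [CommRing k] [Ring H] [Ring A]
    [HopfAlgebra k H] [Algebra k A] where
  act : A →ₗ[k] H →ₗ[k] A
  act_mul : ∀ (a : A) (g g' : H), act a (g * g') = act (act a g) g'
  act_one : ∀ a : A, act a 1 = a
  mul_act : ∀ (a a' : A) (g : H),
    act (a * a') g =
      LinearMap.mul' k A (TensorProduct.map (act a) (act a') (Coalgebra.comul (R := k) g))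
  one_act : ∀ g : H, act 1 g = algebraMap k A (Coalgebra.counit (R := k) g)

/-- A model of the cross product algebra `A ⋊ H`: a unital associative `k`-algebra `B`
with algebra maps `j : A → B`, `ι : H → B` such that `g ⊗ a ↦ ι(g) j(a)` is a linear
isomorphism `H ⊗ₖ A ≃ B` and `j(a) ι(g) = Σ ι(g₍₁₎) j(a ◁ g₍₂₎)`. -/
structure CrossProductModel (k H A B : Type*) [CommRing k] [Ring H] [Ring A] [Ring B]
    [HopfAlgebra k H] [Algebra k A] [Algebra k B]
    (ma : RightModuleAlgebra k H A) where
  j : A →ₐ[k] B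
  ι : H →ₐ[k] B
  mul_bij : Function.Bijective
    ((LinearMap.mul' k B) ∘ₗ (TensorProduct.map ι.toLinearMap j.toLinearMap))
  straighten : ∀ (a : A) (g : H),
    j a * ι g =
      LinearMap.mul' k B
        (TensorProduct.map ι.toLinearMap (j.toLinearMap ∘ₗ ma.act a)
          (Coalgebra.comul (R := k) g))

/-- A realization of `H` in `A`: an algebra homomorphism `f : H → A` such that
`a · f(g) = Σ f(g₍₁₎) · (a ◁ g₍₂₎)` for all `a ∈ A`, `g ∈ H`. -/
def IsRealization {k H A : Type*} [CommRing k] [Ring H] [Ring A]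
    [HopfAlgebra k H] [Algebra k A]
    (ma : RightModuleAlgebra k H A) (f : H →ₐ[k] A) : Prop :=
  ∀ (a : A) (g : H),
    a * f g =
      LinearMap.mul' k A
        (TensorProduct.map f.toLinearMap (ma.act a) (Coalgebra.comul (R := k) g))

/-- The map `ζ : H → B`, `ζ(g) = Σ ι(g₍₁₎) · j(f(S g₍₂₎))`. -/
noncomputable def zeta {k H A B : Type*} [CommRing k] [Ring H] [Ring A] [Ring B]
    [HopfAlgebra k H] [Algebra k A] [Algebra k B]
    {ma : RightModuleAlgebra k H A} (cp : CrossProductModel k H A B ma)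
    (f : H →ₐ[k] A) : H →ₗ[k] B :=
  LinearMap.mul' k B ∘ₗ
    TensorProduct.map cp.ι.toLinearMap
      (cp.j.toLinearMap ∘ₗ f.toLinearMap ∘ₗ (HopfAlgebra.antipode (R := k) (A := H))) ∘ₗ
    Coalgebra.comul (R := k)


open Coalgebra HopfAlgebra WithConv

section TensorCenter

variable {k H A : Type*} [Field k] [Ring H] [Ring A] [Algebra k H] [Algebra k A]

/-- Over a field, the center of a tensor product of algebras is spanned by the tensors of central
elements. -/
theorem center_tensorProduct_le_span :
    Subalgebra.toSubmodule (Subalgebra.center k (H ⊗[k] A)) ≤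
      Submodule.span k {x | ∃ w ∈ Set.center H, ∃ z ∈ Set.center A, x = w ⊗ₜ[k] z} := by
  intro x hx
  have hx' : x ∈ Subalgebra.center k (H ⊗[k] A) := hx
  rw [Subalgebra.mem_center_iff] at hx'
  have h₁ : x ∈ (Algebra.TensorProduct.map (Subalgebra.center k H).val (AlgHom.id k A)).range := by
    rw [← Subalgebra.centralizer_coe_range_includeLeft_eq_center_tensorProduct,
      Subalgebra.mem_centralizer_iff]
    exact fun g _ => hx' g
  obtain ⟨y, rfl⟩ := h₁
  have hinj : Function.Injective
      (Algebra.TensorProduct.map (Subalgebra.center k H).val (AlgHom.id k A)) :=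
    Module.Flat.rTensor_preserves_injective_linearMap (M := A)
      (Subalgebra.center k H).val.toLinearMap Subtype.val_injective
  have h₂ : y ∈ (Algebra.TensorProduct.map (AlgHom.id k (Subalgebra.center k H))
      (Subalgebra.center k A).val).range := by
    rw [← Subalgebra.centralizer_range_includeRight_eq_center_tensorProduct,
      Subalgebra.mem_centralizer_iff]
    intro g _
    apply hinj
    rw [map_mul, map_mul]
    exact hx' _
  obtain ⟨t, rfl⟩ := h₂
  clear hx hx'
  induction t using TensorProduct.induction_on with
  | zero => simp
  | tmul w z => exact Submodule.subset_span ⟨w, w.2, z, z.2, rfl⟩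
  | add s t hs ht => simpa only [map_add] using add_mem hs ht

end TensorCenter

section Convolution

variable {k H A B C : Type*} [CommRing k] [Ring H] [Ring A] [Ring B] [Ring C]
  [HopfAlgebra k H] [Algebra k A] [Algebra k B] [Algebra k C]

/-- The map `g ⊗ a ↦ p(g) i(a)`. -/
noncomputable abbrev mulMap (p : H →ₗ[k] C) (i : A →ₐ[k] C) : H ⊗[k] A →ₗ[k] C :=
  LinearMap.mul' k C ∘ₗ TensorProduct.map p i.toLinearMap

/-- The endomorphism `g ⊗ a ↦ Σ g₍₁₎ ⊗ u(g₍₂₎) a` of `H ⊗ A`. -/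
noncomputable def twist (u : H →ₗ[k] A) : H ⊗[k] A →ₗ[k] H ⊗[k] A :=
  mulMap (toConv (Algebra.TensorProduct.includeLeft : H →ₐ[k] H ⊗[k] A).toLinearMap *
      toConv ((Algebra.TensorProduct.includeRight : A →ₐ[k] H ⊗[k] A).toLinearMap ∘ₗ u)).ofConv
    Algebra.TensorProduct.includeRight

theorem mulMap_comp_twist (p : H →ₗ[k] C) (i : A →ₐ[k] C) (u : H →ₗ[k] A) :
    mulMap p i ∘ₗ twist u = mulMap (toConv p * toConv (i.toLinearMap ∘ₗ u)).ofConv i := by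
  ext g a
  have h₁ := (ℛ k g).convMul_apply (toConv p) (toConv (i.toLinearMap ∘ₗ u))
  have h₂ := (ℛ k g).convMul_apply
    (toConv (Algebra.TensorProduct.includeLeft : H →ₐ[k] H ⊗[k] A).toLinearMap)
    (toConv ((Algebra.TensorProduct.includeRight : A →ₐ[k] H ⊗[k] A).toLinearMap ∘ₗ u))
  simp only [twist, TensorProduct.AlgebraTensorModule.curry_apply, LinearMap.restrictScalars_self,
    TensorProduct.curry_apply, LinearMap.comp_apply, TensorProduct.map_tmul,
    LinearMap.mul'_apply]
  change mulMap p i ((toConv _ * toConv _ : WithConv (H →ₗ[k] H ⊗[k] A)) g * _) =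
    (toConv p * toConv (i.toLinearMap ∘ₗ u)) g * _
  rw [h₁, h₂]
  simp [Finset.sum_mul, mul_assoc]

theorem twist_comp_twist {u v : H →ₗ[k] A} (h : toConv u * toConv v = 1) :
    twist u ∘ₗ twist v = LinearMap.id := by
  rw [twist, mulMap_comp_twist, toConv_ofConv, mul_assoc]
  have h' := LinearMap.algHom_comp_convMul_distrib
    (Algebra.TensorProduct.includeRight : A →ₐ[k] H ⊗[k] A) (toConv u) (toConv v)
  have h₁ : toConv ((Algebra.TensorProduct.includeRight : A →ₐ[k] H ⊗[k] A).toLinearMap ∘ₗ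
      (1 : WithConv (H →ₗ[k] A)).ofConv) = 1 := by
    ext g
    simp [LinearMap.convOne_def, Algebra.algebraMap_eq_smul_one, Algebra.TensorProduct.one_def,
      TensorProduct.smul_tmul']
  rw [h] at h'
  rw [h', ofConv_toConv, ofConv_toConv, toConv_ofConv] at h₁
  rw [h₁, mul_one]
  ext g a
  simp

theorem comp_convMul_comp_antipode (p : H →ₐ[k] C) :
    toConv p.toLinearMap * toConv (p.toLinearMap ∘ₗ antipode k) = 1 := by
  have h := LinearMap.algHom_comp_convMul_distrib p (toConv LinearMap.id)
    (toConv (antipode k (A := H)))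
  rw [LinearMap.id_mul_antipode] at h
  apply WithConv.ofConv_injective
  refine Eq.trans h.symm ?_
  ext g
  simp [LinearMap.convOne_def]

theorem comp_antipode_convMul_comp (p : H →ₐ[k] C) :
    toConv (p.toLinearMap ∘ₗ antipode k) * toConv p.toLinearMap = 1 := by
  have h := LinearMap.algHom_comp_convMul_distrib p (toConv (antipode k (A := H)))
    (toConv LinearMap.id)
  rw [LinearMap.antipode_mul_id] at h
  apply WithConv.ofConv_injective
  refine Eq.trans h.symm ?_
  ext g
  simp [LinearMap.convOne_def]

theorem twist_bijective (f : H →ₐ[k] A) :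
    Function.Bijective (twist (f.toLinearMap ∘ₗ antipode k)) :=
  ⟨Function.LeftInverse.injective (g := twist f.toLinearMap)
      (LinearMap.congr_fun (twist_comp_twist (comp_convMul_comp_antipode f))),
    Function.RightInverse.surjective (g := twist f.toLinearMap)
      (LinearMap.congr_fun (twist_comp_twist (comp_antipode_convMul_comp f)))⟩

/-- The scalar-like element `g ↦ ε(g) c` of the convolution algebra. -/
noncomputable def convConst (k H : Type*) {C : Type*} [CommRing k] [Ring H] [Ring C]
    [HopfAlgebra k H] [Algebra k C] (c : C) : WithConv (H →ₗ[k] C) :=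
  toConv ((counit (R := k) (A := H)).smulRight c)

theorem convConst_mul_apply (c : C) (p : WithConv (H →ₗ[k] C)) (g : H) :
    (convConst k H c * p) g = c * p g := by
  rw [(ℛ k g).convMul_apply]
  conv_rhs => rw [← sum_counit_smul (ℛ k g)]
  simp [convConst, Finset.mul_sum]

theorem mul_convConst_apply (c : C) (p : WithConv (H →ₗ[k] C)) (g : H) :
    (p * convConst k H c) g = p g * c := by
  rw [(ℛ k g).convMul_apply]
  have h : ∑ i ∈ (ℛ k g).index, counit (R := k) ((ℛ k g).right i) • (ℛ k g).left i = g := by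
    have h' := congr(TensorProduct.rid k H $(sum_tmul_counit_eq (ℛ k g)))
    simpa only [map_sum, TensorProduct.rid_tmul, one_smul] using h'
  conv_rhs => rw [← h]
  simp [convConst, Finset.sum_mul]

end Convolution

section CrossProduct

variable {k H A B : Type*} [CommRing k] [Ring H] [Ring A] [Ring B]
  [HopfAlgebra k H] [Algebra k A] [Algebra k B]
  {ma : RightModuleAlgebra k H A} (cp : CrossProductModel k H A B ma) (f : H →ₐ[k] A)

theorem toConv_zeta : toConv (zeta cp f) = toConv cp.ι.toLinearMap *
    toConv ((cp.j.comp f).toLinearMap ∘ₗ antipode k) := rfl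

variable {f} in
theorem j_mul_zeta (hf : IsRealization ma f) (a : A) (g : H) :
    cp.j a * zeta cp f g = zeta cp f g * cp.j a := by
  set c := convConst k H (cp.j a)
  set J := toConv (cp.j.comp f).toLinearMap
  set J' := toConv ((cp.j.comp f).toLinearMap ∘ₗ antipode k)
  set α := toConv (cp.j.toLinearMap ∘ₗ ma.act a)
  have hι : c * toConv cp.ι.toLinearMap = toConv cp.ι.toLinearMap * α := by
    ext g
    exact (convConst_mul_apply _ _ g).trans (cp.straighten a g)
  have hJ : c * J = J * α := by
    ext g
    have h := LinearMap.algHom_comp_convMul_distrib cp.j (toConv f.toLinearMap)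
      (toConv (ma.act a))
    refine (convConst_mul_apply _ _ g).trans ?_
    refine Eq.trans ?_ (LinearMap.congr_fun h g)
    exact (map_mul cp.j a (f g)).symm.trans congr(cp.j $(hf a g))
  have h : c * toConv (zeta cp f) = toConv (zeta cp f) * c := by
    have hα : α = J' * c * J := by
      rw [mul_assoc, hJ, ← mul_assoc, comp_antipode_convMul_comp, one_mul]
    rw [toConv_zeta, ← mul_assoc, hι, hα, mul_assoc, mul_assoc (J' * c),
      comp_convMul_comp_antipode, mul_one, mul_assoc]
  rw [← ofConv_toConv (zeta cp f)]
  exact (convConst_mul_apply _ _ g).symm.trans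
    (congr($h g).trans (mul_convConst_apply _ _ g))

theorem zeta_apply {g : H} {ι : Type*} (r : Repr k g ι) :
    zeta cp f g =
      ∑ i ∈ r.index, cp.ι (r.left i) * cp.j (f (antipode k (r.right i))) := by
  simp [zeta, ← r.eq]

theorem zeta_one : zeta cp f 1 = 1 := by
  simp [zeta, Algebra.TensorProduct.one_def]

variable {f} in
theorem zeta_mul (hf : IsRealization ma f) (g h : H) :
    zeta cp f (g * h) = zeta cp f g * zeta cp f h := by
  have key : ∀ i, cp.ι ((ℛ k g).left i) * cp.j (f (antipode k ((ℛ k g).right i))) *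
      zeta cp f h = ∑ l ∈ (ℛ k h).index, cp.ι ((ℛ k g).left i * (ℛ k h).left l) *
        cp.j (f (antipode k ((ℛ k g).right i * (ℛ k h).right l))) := by
    intro i
    rw [mul_assoc, j_mul_zeta cp hf, zeta_apply cp f (ℛ k h), Finset.sum_mul, Finset.mul_sum]
    simp [antipode_mul_antidistrib, mul_assoc]
  rw [zeta_apply cp f (ℛ k g), Finset.sum_mul, Finset.sum_congr rfl fun i _ => key i,
    zeta_apply cp f ((ℛ k g).mul (ℛ k h))]
  simp [Finset.sum_product]

/-- The map `ζ` as an algebra homomorphism. -/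
noncomputable def zetaAlgHom (hf : IsRealization ma f) : H →ₐ[k] B :=
  .ofLinearMap (zeta cp f) (zeta_one cp f) (zeta_mul cp hf)

theorem mulMap_zeta_bijective : Function.Bijective (mulMap (zeta cp f) cp.j) := by
  have h : mulMap (zeta cp f) cp.j =
      mulMap cp.ι.toLinearMap cp.j ∘ₗ twist (f.toLinearMap ∘ₗ antipode k) := by
    rw [mulMap_comp_twist]
    rfl
  rw [h]
  exact cp.mul_bij.comp (twist_bijective f)

/-- The algebra isomorphism `g ⊗ a ↦ ζ(g) j(a)` from `H ⊗ A` to the cross product. -/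
noncomputable def tensorEquiv (hf : IsRealization ma f) : H ⊗[k] A ≃ₐ[k] B :=
  .ofBijective
    (Algebra.TensorProduct.lift (zetaAlgHom cp f hf) cp.j
      fun g a => (j_mul_zeta cp hf a g).symm) <| by
    have h : (Algebra.TensorProduct.lift (zetaAlgHom cp f hf) cp.j
        fun g a => (j_mul_zeta cp hf a g).symm).toLinearMap = mulMap (zeta cp f) cp.j := by
      ext g a
      simp [zetaAlgHom]
    have hb := mulMap_zeta_bijective cp f
    rw [← h] at hb
    exact hb

theorem tensorEquiv_tmul (hf : IsRealization ma f) (g : H) (a : A) :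
    tensorEquiv cp f hf (g ⊗ₜ a) = zeta cp f g * cp.j a := by
  simp [tensorEquiv, zetaAlgHom]

end CrossProduct

/-- the center of `B` equals the `k`-linear span of the products
`j(z) · ζ(w)` with `z ∈ Z(A)` and `w ∈ Z(H)`: `Z(B) = Z(A) · ζ(Z(H))`. -/
theorem center_eq_span {k H A B : Type*} [Field k] [Ring H] [Ring A] [Ring B]
    [HopfAlgebra k H] [Algebra k A] [Algebra k B]
    (ma : RightModuleAlgebra k H A) (cp : CrossProductModel k H A B ma)
    (f : H →ₐ[k] A) (hf : IsRealization ma f) :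
    Subalgebra.toSubmodule (Subalgebra.center k B) =
      Submodule.span k
        {x : B | ∃ z ∈ Set.center A, ∃ w ∈ Set.center H, x = cp.j z * zeta cp f w} := by
  let e := tensorEquiv cp f hf
  apply le_antisymm
  · intro x hx
    have hy : e.symm x ∈ Subalgebra.toSubmodule (Subalgebra.center k (H ⊗[k] A)) :=
      (MulEquivClass.apply_mem_center_iff e.symm).mpr hx
    have h := Submodule.mem_map_of_mem (f := e.toLinearMap) (center_tensorProduct_le_span hy)
    rw [Submodule.map_span] at h
    have hx' : e.toLinearMap (e.symm x) = x := e.apply_symm_apply x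
    rw [hx'] at h
    refine Submodule.span_mono ?_ h
    rintro _ ⟨_, ⟨w, hw, z, hz, rfl⟩, rfl⟩
    exact ⟨z, hz, w, hw, (tensorEquiv_tmul cp f hf w z).trans (j_mul_zeta cp hf z w).symm⟩
  · rw [Submodule.span_le]
    rintro _ ⟨z, hz, w, hw, rfl⟩
    have hwc : w ⊗ₜ[k] (1 : A) ∈ Subalgebra.center k (H ⊗[k] A) :=
      Algebra.TensorProduct.includeLeft_map_center_le k H A ⟨w, hw, rfl⟩
    have hzc : (1 : H) ⊗ₜ[k] z ∈ Subalgebra.center k (H ⊗[k] A) :=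
      Algebra.TensorProduct.includeRight_map_center_le k H A ⟨z, hz, rfl⟩
    have h : e (1 ⊗ₜ[k] z * w ⊗ₜ[k] 1) ∈ Set.center B :=
      (MulEquivClass.apply_mem_center_iff e).mpr (mul_mem hzc hwc)
    rw [map_mul, tensorEquiv_tmul, tensorEquiv_tmul, zeta_one, map_one, one_mul, mul_one] at h
    exact h
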